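/- Let T = (−∞,−1] ∪ [1,∞) ∪ ℚ ⊆ ℝ. For every α ∈ (0,1) and every β ∈ (0, 1/2), player I has a winning strategy in Schmidt's (α,β) game on ℝ (with the usual metric) with target set T (so that I wins iff the intersection point does not lie in T). -/

import Mathlib

open Filter Topology

/-- The history (the list of moves) of the first `n` moves of the run `f`. -/
def histOf {M : Type*} (f : ℕ → M) (n : ℕ) : List M := (List.range n).map f

/-- The axiom of determinacy `AD` for integer games: for every payoff set
`A ⊆ ℕ^ℕ`, in the game where I plays `x (2k)` and II plays `x (2k+1)`, and I wins
iff `x ∈ A`, one of the players has a winning strategy. -/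
def AD : Prop :=
  ∀ A : Set (ℕ → ℕ),
    (∃ σ : List ℕ → ℕ, ∀ x : ℕ → ℕ, (∀ k, x (2 * k) = σ (histOf x (2 * k))) → x ∈ A) ∨
    (∃ τ : List ℕ → ℕ, ∀ x : ℕ → ℕ, (∀ k, x (2 * k + 1) = τ (histOf x (2 * k + 1))) → x ∉ A)

/-- A specification of an infinite two-player game with moves in `M`:
`firstOK` constrains the first move, `moveOK` constrains every single move,
`stepOK i` constrains consecutive moves (at indices `i`, `i+1`), and `payoffII`
is the winning condition for player II on rule-following runs. -/
structure GameSpec (M : Type*) where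
  firstOK : M → Prop
  moveOK : M → Prop
  stepOK : ℕ → M → M → Prop
  payoffII : (ℕ → M) → Prop

namespace GameSpec

variable {M : Type*} (G : GameSpec M)

/-- The first `n` moves of the run `f` follow the rules. -/
def LegalUpTo (f : ℕ → M) (n : ℕ) : Prop :=
  (0 < n → G.firstOK (f 0)) ∧ (∀ i < n, G.moveOK (f i)) ∧
    ∀ i, i + 1 < n → G.stepOK i (f i) (f (i + 1))

/-- The whole run `f` follows the rules. -/
def Legal (f : ℕ → M) : Prop :=
  G.firstOK (f 0) ∧ (∀ i, G.moveOK (f i)) ∧ ∀ i, G.stepOK i (f i) (f (i + 1))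

/-- A finite position (a finite sequence of moves) follows the rules. -/
def ListLegal (p : List M) : Prop :=
  ∃ f : ℕ → M, histOf f p.length = p ∧ G.LegalUpTo f p.length

/-- Player I (who makes the even-indexed moves) follows strategy `σ` in the run `f`. -/
def FollowsI (σ : List M → M) (f : ℕ → M) : Prop :=
  ∀ k, f (2 * k) = σ (histOf f (2 * k))

/-- Player II (who makes the odd-indexed moves) follows strategy `τ` in the run `f`. -/
def FollowsII (τ : List M → M) (f : ℕ → M) : Prop :=
  ∀ k, f (2 * k + 1) = τ (histOf f (2 * k + 1))

/-- `σ` is a winning strategy for player I: whenever player I follows `σ`, player I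
never violates the rules first, and if the whole run follows the rules then the run
is won by player I (i.e. it does not satisfy player II's payoff condition). -/
def WinningI (σ : List M → M) : Prop :=
  ∀ f : ℕ → M, FollowsI σ f →
    (∀ n, G.LegalUpTo f (2 * n) → G.LegalUpTo f (2 * n + 1)) ∧
      (G.Legal f → ¬ G.payoffII f)

/-- `τ` is a winning strategy for player II: whenever player II follows `τ`, player II
never violates the rules first, and if the whole run follows the rules then the run
satisfies player II's payoff condition. -/
def WinningII (τ : List M → M) : Prop :=
  ∀ f : ℕ → M, FollowsII τ f →
    (∀ n, G.LegalUpTo f (2 * n + 1) → G.LegalUpTo f (2 * n + 2)) ∧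
      (G.Legal f → G.payoffII f)

/-- The game is determined: one of the two players has a winning strategy. -/
def Determined : Prop := (∃ σ, G.WinningI σ) ∨ (∃ τ, G.WinningII τ)

end GameSpec

/-- Schmidt's `(α, β)` game on the metric space `X` with target set `T`.
Moves are pairs `(center, radius)`; the first radius must be positive, each ball
must be contained in the previous one (`ρ_{i+1} + d(x_i, x_{i+1}) ≤ ρ_i`), radii
shrink by `α` after an even-indexed (player I) move and by `β` after an
odd-indexed (player II) move.  Player II wins a rule-following run iff the unique
point of intersection of the balls (the limit of the centers) lies in `T`. -/
def schmidtGame {X : Type*} [MetricSpace X] (α β : ℝ) (T : Set X) :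
    GameSpec (X × ℝ) where
  firstOK m := 0 < m.2
  moveOK _ := True
  stepOK i prev next :=
    next.2 + dist prev.1 next.1 ≤ prev.2 ∧ next.2 = (if Even i then α else β) * prev.2
  payoffII f := ∃ z ∈ T, Tendsto (fun n => (f n).1) atTop (𝓝 z)

/-- Schmidt's `(α, β, ρ)` game: like the `(α, β)` game but the first radius must be `ρ`. -/
def schmidtGameFixed {X : Type*} [MetricSpace X] (α β ρ : ℝ) (T : Set X) :
    GameSpec (X × ℝ) :=
  { schmidtGame α β T with firstOK := fun m => m.2 = ρ }

theorem histOf_succ {M : Type*} (f : ℕ → M) (n : ℕ) : histOf f (n + 1) = histOf f n ++ [f n] := by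
  simp [histOf, List.range_succ]

theorem length_histOf {M : Type*} (f : ℕ → M) (n : ℕ) : (histOf f n).length = n := by
  simp [histOf]

section Schmidt

variable {X : Type*} [MetricSpace X] {α β : ℝ} {T : Set X} {f : ℕ → X × ℝ}

theorem schmidtGame_radius_pos (hα : 0 < α) (hβ : 0 < β) {n : ℕ}
    (hf : (schmidtGame α β T).LegalUpTo f n) {i : ℕ} (hi : i < n) : 0 < (f i).2 := by
  induction i with
  | zero => exact hf.1 hi
  | succ i ih =>
    rw [(hf.2.2 i hi).2]
    have := ih (by omega)
    split_ifs <;> positivity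

theorem GameSpec.Legal.legalUpTo {M : Type*} {G : GameSpec M} {f : ℕ → M} (hf : G.Legal f)
    (n : ℕ) : G.LegalUpTo f n :=
  ⟨fun _ => hf.1, fun i _ => hf.2.1 i, fun i _ => hf.2.2 i⟩

theorem schmidtGame_dist_limit_le (hα : 0 < α) (hβ : 0 < β)
    (hf : (schmidtGame α β T).Legal f) {z : X}
    (hz : Tendsto (fun n => (f n).1) atTop (𝓝 z)) (i : ℕ) : dist (f i).1 z ≤ (f i).2 := by
  have nested : ∀ k, (f (i + k)).2 + dist (f i).1 (f (i + k)).1 ≤ (f i).2 := by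
    intro k
    induction k with
    | zero => simp
    | succ k ih =>
      have step := (hf.2.2 (i + k)).1
      have tri := dist_triangle (f i).1 (f (i + k)).1 (f (i + k + 1)).1
      rw [← add_assoc]
      linarith
  refine le_of_tendsto (tendsto_const_nhds.dist hz) ?_
  filter_upwards [eventually_ge_atTop i] with j hj
  obtain ⟨k, rfl⟩ := Nat.exists_eq_add_of_le hj
  have := schmidtGame_radius_pos hα hβ (hf.legalUpTo (i + k + 1)) (Nat.lt_succ_self (i + k))
  linarith [nested k]

end Schmidt

/-- The strategy for player I which opens with the ball of radius `1 / 2` around `0`, and whose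
`k`-th reply is pushed as far as possible away from the point `e k`. -/
noncomputable def avoidStrategy (β : ℝ) (e : ℕ → ℝ) (p : List (ℝ × ℝ)) : ℝ × ℝ :=
  match p.getLast? with
  | none => (0, 1 / 2)
  | some m =>
    (if e (p.length / 2 - 1) ≤ m.1 then m.1 + (1 - β) * m.2 else m.1 - (1 - β) * m.2, β * m.2)

theorem avoidStrategy_histOf_zero (β : ℝ) (e : ℕ → ℝ) (f : ℕ → ℝ × ℝ) :
    avoidStrategy β e (histOf f 0) = (0, 1 / 2) := by
  simp [avoidStrategy, histOf]

theorem avoidStrategy_histOf_two_mul_succ (β : ℝ) (e : ℕ → ℝ) (f : ℕ → ℝ × ℝ) (k : ℕ) :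
    avoidStrategy β e (histOf f (2 * (k + 1))) =
      (if e k ≤ (f (2 * k + 1)).1 then (f (2 * k + 1)).1 + (1 - β) * (f (2 * k + 1)).2
        else (f (2 * k + 1)).1 - (1 - β) * (f (2 * k + 1)).2, β * (f (2 * k + 1)).2) := by
  have hlen : (histOf f (2 * (k + 1))).length / 2 - 1 = k := by
    rw [length_histOf]
    omega
  have hlast : (histOf f (2 * (k + 1))).getLast? = some (f (2 * k + 1)) := by
    rw [show 2 * (k + 1) = 2 * k + 1 + 1 by ring, histOf_succ]
    simp
  simp only [avoidStrategy, hlast, hlen]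

/-- For the target set `T = (-∞, -1] ∪ [1, ∞) ∪ ℚ ⊆ ℝ`, every `α ∈ (0,1)` and every
`β ∈ (0, 1/2)`, player I has a winning strategy in Schmidt's `(α, β)` game on `ℝ`
with target set `T` (player I wins iff the intersection point is not in `T`). -/
theorem playerI_wins_example_game
    (α β : ℝ) (hα : α ∈ Set.Ioo (0 : ℝ) 1) (hβ : β ∈ Set.Ioo (0 : ℝ) (1 / 2)) :
    ∃ σ, (schmidtGame α β
      (Set.Iic (-1 : ℝ) ∪ Set.Ici (1 : ℝ) ∪ Set.range ((↑) : ℚ → ℝ))).WinningI σ := by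
  obtain ⟨hα, -⟩ := hα
  obtain ⟨hβ, hβ'⟩ := hβ
  obtain ⟨e, he⟩ := exists_surjective_nat ℚ
  refine ⟨avoidStrategy β (fun k => (e k : ℝ)), fun f hfI => ?_⟩
  have first : f 0 = (0, 1 / 2) := (hfI 0).trans (avoidStrategy_histOf_zero ..)
  have reply := fun k => (hfI (k + 1)).trans (avoidStrategy_histOf_two_mul_succ ..)
  refine ⟨fun n hn => ?_, fun hf => ?_⟩
  · refine ⟨fun _ => ?_, fun _ _ => trivial, fun i hi => ?_⟩
    · simp [schmidtGame, first]
    · by_cases hin : i + 1 < 2 * n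
      · exact hn.2.2 i hin
      · obtain ⟨k, rfl⟩ : ∃ k, n = k + 1 := ⟨n - 1, by omega⟩
        obtain rfl : i = 2 * k + 1 := by omega
        have hr := schmidtGame_radius_pos hα hβ hn (i := 2 * k + 1) (by omega)
        have hd : 0 < (1 - β) * (f (2 * k + 1)).2 := mul_pos (by linarith) hr
        have hodd : ¬ Even (2 * k + 1) := by simp
        change (f (2 * (k + 1))).2 + dist _ (f (2 * (k + 1))).1 ≤ _ ∧ (f (2 * (k + 1))).2 = _
        rw [reply k, if_neg hodd]
        refine ⟨?_, rfl⟩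
        dsimp only
        split_ifs <;> simp only [dist_self_add_right, dist_self_sub_right, Real.norm_eq_abs,
          abs_of_pos hd] <;> linarith
  · rintro ⟨z, hzT, hz⟩
    have hball := schmidtGame_dist_limit_le hα hβ hf hz
    have h0 := abs_le.1 ((Real.dist_eq _ _).symm.trans_le (hball 0))
    simp only [first] at h0
    rcases hzT with (h | h) | ⟨q, rfl⟩
    · linarith [Set.mem_Iic.1 h]
    · linarith [Set.mem_Ici.1 h]
    · obtain ⟨k, rfl⟩ := he q
      have hr := schmidtGame_radius_pos hα hβ (hf.legalUpTo (2 * k + 2)) (i := 2 * k + 1)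
        (by omega)
      have hlt : β * (f (2 * k + 1)).2 < (1 - β) * (f (2 * k + 1)).2 :=
        mul_lt_mul_of_pos_right (by linarith) hr
      have hk := abs_le.1 ((Real.dist_eq _ _).symm.trans_le (hball (2 * (k + 1))))
      rw [reply k] at hk
      dsimp only at hk
      split_ifs at hk <;> linarith
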